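/- Let k ≥ 4 and let G be a connected, false twin-free, total k-uniform graph. Then G contains an induced cycle of length 5 or an induced cycle of length 6. -/

import Mathlib

open SimpleGraph

/-- `A ⊆ V(G)` is a total dominating set of `G`: every vertex has a neighbor in `A`. -/
def TotalDomSet {V : Type*} (G : SimpleGraph V) (A : Set V) : Prop :=
  ∀ v : V, ∃ a ∈ A, G.Adj v a

/-- `s` is a legal (open neighborhood) sequence of `G`: the vertices are distinct and every
vertex after the first has a neighbor adjacent to no vertex preceding it in the sequence. -/
def LegalSeq {V : Type*} (G : SimpleGraph V) (s : List V) : Prop :=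
  s.Nodup ∧ ∀ (i : ℕ) (h : i < s.length), 0 < i →
    ∃ w : V, G.Adj (s.get ⟨i, h⟩) w ∧ ∀ u ∈ s.take i, ¬ G.Adj u w

/-- `s` is a total dominating sequence of `G`: a legal sequence whose underlying set is a
total dominating set. -/
def TotalDomSeq {V : Type*} (G : SimpleGraph V) (s : List V) : Prop :=
  LegalSeq G s ∧ TotalDomSet G {v | v ∈ s}

/-- The total domination number `γ_t(G)`: the minimum size of a total dominating set. -/
noncomputable def totalDomNum {V : Type*} (G : SimpleGraph V) : ℕ :=
  sInf {n | ∃ A : Set V, TotalDomSet G A ∧ A.ncard = n}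

/-- The Grundy total domination number `γ_gr^t(G)`: the maximum length of a total dominating
sequence. -/
noncomputable def grundyTotalDomNum {V : Type*} (G : SimpleGraph V) : ℕ :=
  sSup {n | ∃ s : List V, TotalDomSeq G s ∧ s.length = n}

/-- `G` is total `k`-uniform if `γ_t(G) = γ_gr^t(G) = k`. -/
def TotalKUniform {V : Type*} (G : SimpleGraph V) (k : ℕ) : Prop :=
  totalDomNum G = k ∧ grundyTotalDomNum G = k

/-- `G` has no isolated vertices. -/
def NoIsolatedVerts {V : Type*} (G : SimpleGraph V) : Prop :=
  ∀ v : V, ∃ w : V, G.Adj v w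

/-- The closed neighborhood `N[v] = N(v) ∪ {v}`. -/
def closedNbhd {V : Type*} (G : SimpleGraph V) (v : V) : Set V :=
  insert v (G.neighborSet v)

/-- `G` is false twin-free: no two distinct vertices have the same (open) neighborhood. -/
def FalseTwinFree {V : Type*} (G : SimpleGraph V) : Prop :=
  ∀ u v : V, u ≠ v → G.neighborSet u ≠ G.neighborSet v

namespace SimpleGraph

/-- A graph embedding is an isomorphism onto the induced subgraph on its range. -/
theorem Embedding.nonempty_induce_range_iso {V W : Type*} {G : SimpleGraph V} {H : SimpleGraph W}
    (f : H ↪g G) : Nonempty (G.induce (Set.range f) ≃g H) := by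
  refine ⟨Iso.symm ⟨Equiv.ofInjective f f.injective, ?_⟩⟩
  intro a b
  simp

/-- Six vertices with the adjacencies of a 6-cycle induce a 6-cycle. -/
theorem exists_induce_iso_cycleGraph_six {V : Type*} {G : SimpleGraph V} {a b c d e f : V}
    (hab : G.Adj a b) (hbc : G.Adj b c) (hcd : G.Adj c d) (hde : G.Adj d e) (hef : G.Adj e f)
    (hfa : G.Adj f a) (hac : ¬ G.Adj a c) (had : ¬ G.Adj a d) (hae : ¬ G.Adj a e)
    (hbd : ¬ G.Adj b d) (hbe : ¬ G.Adj b e) (hbf : ¬ G.Adj b f) (hce : ¬ G.Adj c e)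
    (hcf : ¬ G.Adj c f) (hdf : ¬ G.Adj d f) :
    ∃ S : Set V, Nonempty (G.induce S ≃g cycleGraph 6) := by
  have hadj : ∀ i j : Fin 6,
      G.Adj (![a, b, c, d, e, f] i) (![a, b, c, d, e, f] j) ↔ (cycleGraph 6).Adj i j := by
    intro i j
    fin_cases i <;> fin_cases j <;>
      simp [cycleGraph_adj, G.adj_comm, *] <;> first | decide | grind [G.adj_comm]
  have hsep : ∀ i j : Fin 6,
      (∀ l, (cycleGraph 6).Adj i l ↔ (cycleGraph 6).Adj j l) → i = j := by
    simp only [cycleGraph_adj]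
    decide
  have hinj : Function.Injective ![a, b, c, d, e, f] := by
    intro i j hij
    refine hsep i j fun l => ?_
    rw [← hadj, ← hadj, hij]
  exact ⟨_, Embedding.nonempty_induce_range_iso ⟨⟨_, hinj⟩, hadj _ _⟩⟩

/-- A connected graph that is not complete contains an induced path on three vertices. -/
theorem Connected.exists_induced_path_three {V : Type*} {G : SimpleGraph V} (hG : G.Connected)
    {x y : V} (hne : x ≠ y) (hxy : ¬ G.Adj x y) :
    ∃ a b c, a ≠ c ∧ G.Adj a b ∧ G.Adj b c ∧ ¬ G.Adj a c := by
  by_contra! h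
  obtain ⟨w⟩ := hG x y
  have key : ∀ {u v : V}, G.Walk u v → u = v ∨ G.Adj u v := by
    intro u v w
    induction w with
    | nil => exact Or.inl rfl
    | @cons u v w huv _ ih =>
      by_cases huw : u = w
      · exact Or.inl huw
      · rcases ih with rfl | hvw
        · exact Or.inr huv
        · exact Or.inr (h u v w huw huv hvw)
  exact (key w).elim hne hxy

end SimpleGraph

section LegalSequences

variable {V : Type*} {G : SimpleGraph V}

theorem LegalSeq.nil : LegalSeq G [] := ⟨List.nodup_nil, by simp⟩

theorem LegalSeq.concat {s : List V} (hs : LegalSeq G s) {v x : V} (hvx : G.Adj v x)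
    (hx : ∀ u ∈ s, ¬ G.Adj u x) : LegalSeq G (s ++ [v]) := by
  refine ⟨?_, ?_⟩
  · have hv : v ∉ s := fun h => hx v h hvx
    simpa [List.nodup_append] using ⟨hs.1, fun a ha h => hv (h ▸ ha)⟩
  · intro i hi h0
    by_cases his : i < s.length
    · obtain ⟨w, hw, hw'⟩ := hs.2 i his h0
      refine ⟨w, ?_, ?_⟩
      · simpa [List.getElem_append_left his] using hw
      · rwa [List.take_append_of_le_length his.le]
    · have hi' : i = s.length := by
        simp at hi
        omega
      subst hi'
      exact ⟨x, by simpa using hvx, by simpa using hx⟩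

/-- A legal sequence in `B` extends to a legal sequence in `B` dominating all that `B` does. -/
theorem LegalSeq.exists_maximal [Finite V] (B : Set V) {s : List V} (hs : LegalSeq G s)
    (hB : ∀ v ∈ s, v ∈ B) :
    ∃ t, LegalSeq G t ∧ (∀ v ∈ s, v ∈ t) ∧ (∀ v ∈ t, v ∈ B) ∧
      ∀ b ∈ B, ∀ x, G.Adj b x → ∃ u ∈ t, G.Adj u x := by
  have := Fintype.ofFinite V
  induction hn : Fintype.card V - s.length using Nat.strong_induction_on generalizing s with
  | _ n ih =>
    by_cases hmax : ∀ b ∈ B, ∀ x, G.Adj b x → ∃ u ∈ s, G.Adj u x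
    · exact ⟨s, hs, fun _ h => h, hB, hmax⟩
    · push Not at hmax
      obtain ⟨b, hb, x, hbx, hx⟩ := hmax
      have hs' := hs.concat hbx hx
      have hlen := hs'.1.length_le_card
      simp only [List.length_append, List.length_singleton] at hlen
      obtain ⟨t, ht, hst, htB, htmax⟩ := ih (Fintype.card V - (s ++ [b]).length)
        (by simp only [List.length_append, List.length_singleton]; omega) hs'
        (by simpa [or_imp, forall_and] using ⟨hB, hb⟩) rfl
      exact ⟨t, ht, fun v hv => hst v (by simp [hv]), htB, htmax⟩

theorem TotalDomSet.totalDomNum_le_length {s : List V} (hs : TotalDomSet G {v | v ∈ s}) :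
    totalDomNum G ≤ s.length := by
  classical
  have hle : totalDomNum G ≤ {v | v ∈ s}.ncard := Nat.sInf_le ⟨_, hs, rfl⟩
  refine hle.trans ?_
  have : {v | v ∈ s} = (s.toFinset : Set V) := by ext; simp
  rw [this, Set.ncard_coe_finset]
  exact s.toFinset_card_le

theorem TotalDomSeq.length_le_grundyTotalDomNum [Finite V] {s : List V} (hs : TotalDomSeq G s) :
    s.length ≤ grundyTotalDomNum G := by
  have := Fintype.ofFinite V
  refine le_csSup ⟨Fintype.card V, ?_⟩ ⟨s, hs, rfl⟩
  rintro _ ⟨t, ht, rfl⟩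
  exact ht.1.1.length_le_card

theorem LegalSeq.exists_totalDomSeq [Finite V] (hiso : NoIsolatedVerts G) {s : List V}
    (hs : LegalSeq G s) : ∃ t, TotalDomSeq G t ∧ ∀ v ∈ s, v ∈ t := by
  obtain ⟨t, ht, hst, -, htmax⟩ := hs.exists_maximal Set.univ (fun _ _ => trivial)
  refine ⟨t, ⟨ht, fun v => ?_⟩, hst⟩
  obtain ⟨w, hw⟩ := hiso v
  obtain ⟨u, hu, huv⟩ := htmax w trivial v hw.symm
  exact ⟨u, hu, huv.symm⟩

end LegalSequences

section TotalUniform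

variable {V : Type*} [Finite V] {G : SimpleGraph V} {k : ℕ}

theorem TotalKUniform.length_le (huni : TotalKUniform G k) (hiso : NoIsolatedVerts G)
    {s : List V} (hs : LegalSeq G s) : s.length ≤ k := by
  obtain ⟨t, ht, hst⟩ := hs.exists_totalDomSeq hiso
  exact (hs.1.subperm hst).length_le.trans (huni.2 ▸ ht.length_le_grundyTotalDomNum)

/-- In a total `k`-uniform graph, every vertex of a legal sequence has a private neighbor. -/
theorem TotalKUniform.exists_private (huni : TotalKUniform G k) (hiso : NoIsolatedVerts G)
    {s : List V} (hs : LegalSeq G s) {w : V} (hw : w ∈ s) :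
    ∃ x, G.Adj w x ∧ ∀ u ∈ s, u ≠ w → ¬ G.Adj u x := by
  classical
  by_contra! h
  obtain ⟨t, ht, hst⟩ := hs.exists_totalDomSeq hiso
  have hwt := hst w hw
  have hdom : TotalDomSet G {v | v ∈ t.erase w} := by
    intro v
    obtain ⟨a, ha, hva⟩ := ht.2 v
    by_cases haw : a = w
    · subst haw
      obtain ⟨u, hu, hne, huv⟩ := h v hva.symm
      exact ⟨u, (List.mem_erase_of_ne hne).2 (hst u hu), huv.symm⟩
    · exact ⟨a, (List.mem_erase_of_ne haw).2 ha, hva⟩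
  have h1 := hdom.totalDomNum_le_length
  have h2 := huni.length_le hiso ht.1
  have h3 := List.length_pos_of_mem hwt
  rw [huni.1, List.length_erase_of_mem hwt] at h1
  omega

theorem TotalKUniform.exists_adj_not_adj (huni : TotalKUniform G k) (hiso : NoIsolatedVerts G)
    (hftf : FalseTwinFree G) {u v : V} (huv : u ≠ v) : ∃ x, G.Adj u x ∧ ¬ G.Adj v x := by
  by_contra! h
  have hvu : ∃ x, G.Adj v x ∧ ¬ G.Adj u x := by
    by_contra! h'
    exact hftf u v huv (Set.ext fun x => ⟨h x, h' x⟩)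
  obtain ⟨x, hvx, hux⟩ := hvu
  obtain ⟨y, hy⟩ := hiso u
  have hs : LegalSeq G [u, v] :=
    (LegalSeq.nil.concat hy (by simp)).concat hvx (by simpa using hux)
  obtain ⟨z, hz, hz'⟩ := huni.exists_private hiso hs (w := u) (by simp)
  exact hz' v (by simp) huv.symm (h z hz)

/-- The exchange property of domination by pairs. -/
theorem TotalKUniform.exchange (huni : TotalKUniform G k) (hiso : NoIsolatedVerts G)
    (hftf : FalseTwinFree G) {u v w : V} (hwv : w ≠ v)
    (h : ∀ x, G.Adj w x → G.Adj u x ∨ G.Adj v x) {x : V} (hu : G.Adj u x) :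
    G.Adj w x ∨ G.Adj v x := by
  by_contra! hx
  obtain ⟨y, hy⟩ := hiso v
  obtain ⟨z, hwz, hvz⟩ := huni.exists_adj_not_adj hiso hftf hwv
  have hs : LegalSeq G [v, w, u] :=
    ((LegalSeq.nil.concat hy (by simp)).concat hwz (by simpa using hvz)).concat hu
      (by simpa using ⟨hx.2, hx.1⟩)
  obtain ⟨p, hp, hp'⟩ := huni.exists_private hiso hs (w := w) (by simp)
  have huw : u ≠ w := by rintro rfl; exact hx.1 hu
  rcases h p hp with h | h
  · exact hp' u (by simp) huw h
  · exact hp' v (by simp) hwv.symm h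

/-- Two vertices with a common neighbor `y` lie on a "line" meeting the non-neighborhood of `y`:
there is a third vertex `w` such that each of the three neighborhoods lies in the union of the
other two. -/
theorem TotalKUniform.exists_third (huni : TotalKUniform G k) (hiso : NoIsolatedVerts G)
    (hftf : FalseTwinFree G) {u v y : V} (huv : u ≠ v) (huy : G.Adj u y) (hvy : G.Adj v y) :
    ∃ w, (∀ x, G.Adj w x → G.Adj u x ∨ G.Adj v x) ∧
      (∀ x, G.Adj u x → G.Adj w x ∨ G.Adj v x) ∧
      (∀ x, G.Adj v x → G.Adj w x ∨ G.Adj u x) := by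
  obtain ⟨s, hs, -, hsB, hsmax⟩ := (LegalSeq.nil (G := G)).exists_maximal
    {b | ¬ G.Adj u b ∧ ¬ G.Adj v b} (by simp)
  obtain ⟨x, hux, hvx⟩ := huni.exists_adj_not_adj hiso hftf huv
  have hlong : LegalSeq G (s ++ [x] ++ [y]) :=
    (hs.concat hux.symm fun b hb h => (hsB b hb).1 h.symm).concat hvy.symm (by
      intro b hb h
      rcases List.mem_append.1 hb with hb | hb
      · exact (hsB b hb).2 h.symm
      · rw [List.mem_singleton.1 hb] at h
        exact hvx h.symm)
  have hlen := huni.length_le hiso hlong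
  have hnot : ¬ TotalDomSet G {b | b ∈ s ++ [y]} := by
    intro h
    have := h.totalDomNum_le_length
    rw [huni.1] at this
    simp at this hlen
    omega
  unfold TotalDomSet at hnot
  push Not at hnot
  obtain ⟨w, hw⟩ := hnot
  have hwy : ¬ G.Adj w y := hw y (by simp)
  have hw1 : ∀ z, G.Adj w z → G.Adj u z ∨ G.Adj v z := by
    intro z hz
    by_contra! hzB
    obtain ⟨b, hb, hbw⟩ := hsmax z hzB w hz.symm
    exact hw b (by simp [hb]) hbw.symm
  have hwu : w ≠ u := by rintro rfl; exact hwy huy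
  have hwv : w ≠ v := by rintro rfl; exact hwy hvy
  exact ⟨w, hw1, fun z hz => huni.exchange hiso hftf hwv hw1 hz,
    fun z hz => huni.exchange hiso hftf hwu (fun z hz => (hw1 z hz).symm) hz⟩

/-- Having a common neighbor is a transitive relation. -/
theorem TotalKUniform.common_nbr_trans (huni : TotalKUniform G k) (hiso : NoIsolatedVerts G)
    (hftf : FalseTwinFree G) {x u y v z : V} (hxu : G.Adj x u) (huy : G.Adj u y)
    (hyv : G.Adj y v) (hvz : G.Adj v z) : ∃ w, G.Adj x w ∧ G.Adj w z := by
  by_contra! h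
  have huz := h u hxu
  have hxv : ¬ G.Adj v x := fun hvx => h v hvx.symm hvz
  have huv : u ≠ v := by rintro rfl; exact huz hvz
  obtain ⟨w, -, hu, hv⟩ := huni.exists_third hiso hftf huv huy hyv.symm
  exact h w ((hu x hxu.symm).resolve_right hxv).symm ((hv z hvz).resolve_right huz)

/-- An induced path on four vertices `a, b, c, d` extends beyond `a` to one on five vertices; the
adjacency of `b` and `c` plays no role. -/
theorem TotalKUniform.exists_extend_path (huni : TotalKUniform G k) (hiso : NoIsolatedVerts G)
    {a b c d : V} (hab : G.Adj a b) (hcd : G.Adj c d) (hac : ¬ G.Adj a c)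
    (had : ¬ G.Adj a d) (hbd : ¬ G.Adj b d) :
    ∃ p, G.Adj a p ∧ ¬ G.Adj b p ∧ ¬ G.Adj c p ∧ ¬ G.Adj d p := by
  have hs : LegalSeq G [a, d, b, c] :=
    (((LegalSeq.nil.concat hab (by simp)).concat hcd.symm (by simpa using hac)).concat hab.symm
      (by simpa [G.adj_comm d a] using had)).concat hcd (by simpa using ⟨had, hbd⟩)
  obtain ⟨p, hap, hp⟩ := huni.exists_private hiso hs (w := a) (by simp)
  refine ⟨p, hap, hp b (by simp) hab.ne', hp c (by simp) ?_, hp d (by simp) ?_⟩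
  · rintro rfl; exact had hcd
  · rintro rfl; exact hac hcd.symm

/-- A total `k`-uniform connected false twin-free graph with an induced path on three vertices
contains an induced 6-cycle. -/
theorem TotalKUniform.exists_induced_cycle_six (huni : TotalKUniform G k)
    (hiso : NoIsolatedVerts G) (hftf : FalseTwinFree G) {a b c : V} (hne : a ≠ c)
    (hab : G.Adj a b) (hbc : G.Adj b c) (hac : ¬ G.Adj a c) :
    ∃ S : Set V, Nonempty (G.induce S ≃g cycleGraph 6) := by
  obtain ⟨e, hce, hae⟩ := huni.exists_adj_not_adj hiso hftf hne.symm
  have hs : LegalSeq G [a, c, b] :=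
    ((LegalSeq.nil.concat hab (by simp)).concat hce (by simpa using hae)).concat hab.symm
      (by simpa [G.adj_comm c a] using hac)
  obtain ⟨d, hcd, hd⟩ := huni.exists_private hiso hs (w := c) (by simp)
  have had : ¬ G.Adj a d := hd a (by simp) hne
  have hbd : ¬ G.Adj b d := hd b (by simp) hbc.ne
  obtain ⟨p, hap, hbp, hcp, hdp⟩ := huni.exists_extend_path hiso hab hcd hac had hbd
  obtain ⟨q, hdq, hcq, hbq, haq⟩ := huni.exists_extend_path hiso hcd.symm hab.symm
    (fun h => hbd h.symm) (fun h => had h.symm) (fun h => hac h.symm)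
  have hexists : ∃ r, G.Adj d r ∧ G.Adj p r ∧ ¬ G.Adj a r ∧ ¬ G.Adj b r ∧ ¬ G.Adj c r := by
    by_cases hpq : G.Adj p q
    · exact ⟨q, hdq, hpq, haq, hbq, hcq⟩
    obtain ⟨q', hpq', haq', hbq', hcq'⟩ := huni.exists_extend_path hiso hap.symm hbc
      (fun h => hbp h.symm) (fun h => hcp h.symm) hac
    by_cases hdq' : G.Adj d q'
    · exact ⟨q', hdq', hpq', haq', hbq', hcq'⟩
    obtain ⟨y, hqy, hya⟩ := huni.common_nbr_trans hiso hftf hdq.symm hcd.symm hbc.symm hab.symm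
    obtain ⟨z, hqz, hzq'⟩ := huni.common_nbr_trans hiso hftf hqy hya hap hpq'
    have hne' : q ≠ q' := by rintro rfl; exact hdq' hdq
    obtain ⟨r, hr, hrq, hrq'⟩ := huni.exists_third hiso hftf hne' hqz hzq'.symm
    have hr' : ∀ x, ¬ G.Adj x q → ¬ G.Adj x q' → ¬ G.Adj x r := fun x h h' hx =>
      (hr x hx.symm).elim (fun h1 => h h1.symm) (fun h1 => h' h1.symm)
    exact ⟨r, ((hrq d hdq.symm).resolve_right fun h => hdq' h.symm).symm,
      ((hrq' p hpq'.symm).resolve_right fun h => hpq h.symm).symm,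
      hr' a haq haq', hr' b hbq hbq', hr' c hcq hcq'⟩
  obtain ⟨r, hdr, hpr, har, hbr, hcr⟩ := hexists
  exact exists_induce_iso_cycleGraph_six hap.symm hab hbc hcd hdr hpr.symm (fun h => hbp h.symm)
    (fun h => hcp h.symm) (fun h => hdp h.symm) hac had har hbd hbr hcr

end TotalUniform

/-- Every connected, false twin-free, total `k`-uniform graph with `k ≥ 4` contains an
induced cycle of length 5 or an induced cycle of length 6. -/
theorem stmt_16 {V : Type*} [Finite V] (G : SimpleGraph V) (k : ℕ) (hk : 4 ≤ k)
    (hiso : NoIsolatedVerts G) (hconn : G.Connected) (hftf : FalseTwinFree G)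
    (huni : TotalKUniform G k) :
    ∃ S : Set V, Nonempty (G.induce S ≃g cycleGraph 5) ∨
      Nonempty (G.induce S ≃g cycleGraph 6) := by
  obtain ⟨v⟩ := hconn.nonempty
  obtain ⟨w, hvw⟩ := hiso v
  have hncomplete : ∃ x y, x ≠ y ∧ ¬ G.Adj x y := by
    by_contra! h
    have hdom : TotalDomSet G {u | u ∈ [v, w]} := by
      intro u
      by_cases hu : u = v
      · exact ⟨w, by simp, hu ▸ hvw⟩
      · exact ⟨v, by simp, h u v hu⟩
    have := hdom.totalDomNum_le_length
    rw [huni.1] at this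
    simp at this
    omega
  obtain ⟨x, y, hne, hxy⟩ := hncomplete
  obtain ⟨a, b, c, hac, hab, hbc, hnac⟩ := hconn.exists_induced_path_three hne hxy
  obtain ⟨S, hS⟩ := huni.exists_induced_cycle_six hiso hftf hac hab hbc hnac
  exact ⟨S, Or.inr hS⟩
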